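/- Let p ∈ [1,∞) and let d_M : M*_c(ℝ^n) × M*_c(ℝ^n) → [0,∞) be a metric such that d_M(m·μ₁, m·μ₂) = f(m)·W_p(μ₁, μ₂) for every m > 0 and every μ₁, μ₂ ∈ P_c(ℝ^n), for some function f : (0,∞) → (0,∞). Suppose that d_M is invariant with respect to the isometries of ℝ^n, i.e. d_M(T#μ₁, T#μ₂) = d_M(μ₁, μ₂) for every isometry T : ℝ^n → ℝ^n and every μ₁, μ₂ ∈ M*_c(ℝ^n), and suppose moreover that lim_{m→m₀} d_M(m·μ, m₀·μ) = 0 for every m₀ > 0 and every μ ∈ P_c(ℝ^n). Then f is constant: f ≡ λ for some λ > 0. -/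

import Mathlib

open MeasureTheory ENNReal

/-- The `p`-Wasserstein distance between two (probability) measures on `ℝⁿ`:
`W_p(μ,ν) = (inf_π ∫ |x-y|^p dπ)^{1/p}`, the infimum running over all couplings of `μ` and `ν`. -/
noncomputable def Wp (n : ℕ) (p : ℝ)
    (μ ν : Measure (EuclideanSpace ℝ (Fin n))) : ℝ :=
  ((sInf {c : ℝ≥0∞ | ∃ π : Measure (EuclideanSpace ℝ (Fin n) × EuclideanSpace ℝ (Fin n)),
      π.map Prod.fst = μ ∧ π.map Prod.snd = ν ∧
      c = ∫⁻ q, edist q.1 q.2 ^ p ∂π}) ^ (1 / p)).toReal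

/-- `μ` has compact support. -/
def CompactSupp {n : ℕ} (μ : Measure (EuclideanSpace ℝ (Fin n))) : Prop :=
  ∃ K : Set (EuclideanSpace ℝ (Fin n)), IsCompact K ∧ μ Kᶜ = 0

/-- `μ ∈ M*_c(ℝⁿ)`: compactly supported, with positive finite mass. -/
def IsMcStar {n : ℕ} (μ : Measure (EuclideanSpace ℝ (Fin n))) : Prop :=
  CompactSupp μ ∧ μ Set.univ ≠ 0 ∧ μ Set.univ ≠ ⊤

/-- `μ ∈ P_c(ℝⁿ)`: compactly supported probability measure. -/
def IsPc {n : ℕ} (μ : Measure (EuclideanSpace ℝ (Fin n))) : Prop :=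
  CompactSupp μ ∧ μ Set.univ = 1

lemma wp_dirac (n : ℕ) (p : ℝ) (hp : 1 ≤ p) (x y : EuclideanSpace ℝ (Fin n)) :
    Wp n p (Measure.dirac x) (Measure.dirac y) = dist x y := by
  have hp0 : p ≠ 0 := by linarith
  have key : {c : ℝ≥0∞ | ∃ π : Measure (EuclideanSpace ℝ (Fin n) × EuclideanSpace ℝ (Fin n)),
      π.map Prod.fst = Measure.dirac x ∧ π.map Prod.snd = Measure.dirac y ∧
      c = ∫⁻ q, edist q.1 q.2 ^ p ∂π} = {edist x y ^ p} := by
    ext c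
    simp only [Set.mem_ofPred_eq, Set.mem_singleton_iff]
    constructor
    · rintro ⟨π, h1, h2, rfl⟩
      have a1 : ∀ᵐ q ∂π, q.1 = x := by
        have : ∀ᵐ z ∂(π.map Prod.fst), z = x := by
          rw [h1, ae_dirac_eq]; simp
        exact ae_of_ae_map measurable_fst.aemeasurable this
      have a2 : ∀ᵐ q ∂π, q.2 = y := by
        have : ∀ᵐ z ∂(π.map Prod.snd), z = y := by
          rw [h2, ae_dirac_eq]; simp
        exact ae_of_ae_map measurable_snd.aemeasurable this
      have hu : π Set.univ = 1 := by
        have : (π.map Prod.fst) Set.univ = 1 := by rw [h1]; simp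
        rwa [Measure.map_apply measurable_fst MeasurableSet.univ, Set.preimage_univ] at this
      have : ∫⁻ q, edist q.1 q.2 ^ p ∂π = ∫⁻ _, edist x y ^ p ∂π := by
        apply lintegral_congr_ae
        filter_upwards [a1, a2] with q b1 b2
        rw [b1, b2]
      rw [this, lintegral_const, hu, mul_one]
    · rintro rfl
      refine ⟨Measure.dirac (x, y), ?_, ?_, ?_⟩
      · rw [Measure.map_dirac' measurable_fst]
      · rw [Measure.map_dirac' measurable_snd]
      · rw [lintegral_dirac]
  unfold Wp
  rw [key, sInf_singleton, ← ENNReal.rpow_mul, mul_one_div_cancel hp0, ENNReal.rpow_one,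
    edist_dist, ENNReal.toReal_ofReal dist_nonneg]

lemma isPc_dirac {n : ℕ} (x : EuclideanSpace ℝ (Fin n)) : IsPc (Measure.dirac x) :=
  ⟨⟨{x}, isCompact_singleton, by simp⟩, by simp⟩

lemma isMc_dirac {n : ℕ} (x : EuclideanSpace ℝ (Fin n)) (m : ℝ) (hm : 0 < m) :
    IsMcStar (ENNReal.ofReal m • Measure.dirac x) :=
  ⟨⟨{x}, isCompact_singleton, by simp⟩, by simp [hm], by simp⟩

theorem statement13 (n : ℕ) (hn : 0 < n) (p : ℝ) (hp : 1 ≤ p)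
    (dM : Measure (EuclideanSpace ℝ (Fin n)) → Measure (EuclideanSpace ℝ (Fin n)) → ℝ)
    -- `dM` is a distance function on `M*_c(ℝⁿ)`
    (hnonneg : ∀ μ ν, IsMcStar μ → IsMcStar ν → 0 ≤ dM μ ν)
    (heq : ∀ μ ν, IsMcStar μ → IsMcStar ν → (dM μ ν = 0 ↔ μ = ν))
    (hsymm : ∀ μ ν, IsMcStar μ → IsMcStar ν → dM μ ν = dM ν μ)
    (htri : ∀ μ ν ρ, IsMcStar μ → IsMcStar ν → IsMcStar ρ → dM μ ρ ≤ dM μ ν + dM ν ρ)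
    -- fiber condition: `dM(m μ₁, m μ₂) = f(m) W_p(μ₁, μ₂)`
    (f : ℝ → ℝ) (hf : ∀ m : ℝ, 0 < m → 0 < f m)
    (hfiber : ∀ m : ℝ, 0 < m → ∀ μ₁ μ₂, IsPc μ₁ → IsPc μ₂ →
      dM (ENNReal.ofReal m • μ₁) (ENNReal.ofReal m • μ₂) = f m * Wp n p μ₁ μ₂)
    -- `dM` is invariant with respect to the isometries of `ℝⁿ`
    (hinv : ∀ T : EuclideanSpace ℝ (Fin n) → EuclideanSpace ℝ (Fin n), Isometry T →
      ∀ μ₁ μ₂, IsMcStar μ₁ → IsMcStar μ₂ → dM (μ₁.map T) (μ₂.map T) = dM μ₁ μ₂)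
    -- continuity in the mass: `dM(m μ, m₀ μ) → 0` as `m → m₀`
    (hcont : ∀ m₀ : ℝ, 0 < m₀ → ∀ μ, IsPc μ →
      Filter.Tendsto (fun m : ℝ => dM (ENNReal.ofReal m • μ) (ENNReal.ofReal m₀ • μ))
        (nhdsWithin m₀ (Set.Ioi 0)) (nhds 0)) :
    ∃ lam > (0 : ℝ), ∀ m : ℝ, 0 < m → f m = lam := by
  have hle : ∀ a b : ℝ, 0 < a → 0 < b → f a ≤ f b := by
    intro a b ha hb
    let D : ℝ → EuclideanSpace ℝ (Fin n) → Measure (EuclideanSpace ℝ (Fin n)) :=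
      fun m x => ENNReal.ofReal m • Measure.dirac x
    have hc : ∀ x, dM (D a x) (D b x) = dM (D a 0) (D b 0) := by
      intro x
      have h := hinv (fun z => x + z) (IsometryEquiv.addLeft x).isometry (D a 0) (D b 0)
        (isMc_dirac 0 a ha) (isMc_dirac 0 b hb)
      rw [← h]
      have hm : Measurable (fun z : EuclideanSpace ℝ (Fin n) => x + z) := by fun_prop
      simp only [D, Measure.map_smul, Measure.map_dirac' hm, add_zero]
    set C := dM (D a 0) (D b 0) with hC
    have hk : ∀ k : ℕ, f a * k ≤ 2 * C + f b * k := by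
      intro k
      let y : EuclideanSpace ℝ (Fin n) := EuclideanSpace.single ⟨0, hn⟩ (k : ℝ)
      have hd : dist (0 : EuclideanSpace ℝ (Fin n)) y = k := by
        simp [y, dist_eq_norm]
      have h1 := hfiber a ha _ _ (isPc_dirac 0) (isPc_dirac y)
      have h2 := hfiber b hb _ _ (isPc_dirac 0) (isPc_dirac y)
      rw [wp_dirac n p hp, hd] at h1 h2
      have m1 := isMc_dirac (0 : EuclideanSpace ℝ (Fin n)) a ha
      have m2 := isMc_dirac (0 : EuclideanSpace ℝ (Fin n)) b hb
      have m3 := isMc_dirac y a ha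
      have m4 := isMc_dirac y b hb
      have t1 := htri _ _ _ m1 m2 m3
      have t2 := htri _ _ _ m2 m4 m3
      have t3 := hsymm _ _ m4 m3
      have t4 := hc y
      simp only [D] at t4 hC
      linarith
    by_contra hlt
    push Not at hlt
    obtain ⟨k, hk'⟩ := exists_nat_gt (2 * C / (f a - f b))
    rw [div_lt_iff₀ (by linarith)] at hk'
    have := hk k
    nlinarith
  exact ⟨f 1, hf 1 one_pos, fun m hm => le_antisymm (hle m 1 hm one_pos) (hle 1 m one_pos hm)⟩
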